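/- Let m ≥ 2 be an integer, N a positive integer, and ω = exp(2πi/N). Then e^{(m−1)² π i / (2mN)} · Σ_{c_1,…,c_{m−1}=0}^{N−1} (−1)^{c_{m−1}} ω^{c_{m−1}(c_{m−1}+1)/2} ( Π_{i=1}^{m−2} ω^{c_i(c_i+1)} [c_{i+1} choose c_i]_ω ) = m Σ_{n=0}^{mN} χ_{2m}^{(0)}(n) ( 1 − n/(mN) ) e^{π i n² / (2mN)}. -/

import Mathlib

open scoped Real BigOperators
open Complex (I)

/-- The Gaussian binomial coefficient `[M choose n]_q` as a function of `q : ℂ`: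
the integer polynomial `Π_{j=1}^{n} (1 − q^{M−n+j})/(1 − q^{j})` evaluated at `q`
(well defined even at roots of unity), equal to `0` unless `M ≥ n ≥ 0`; defined via
the `q`-Pascal recursion. -/
def qBinom (q : ℂ) : ℕ → ℕ → ℂ
  | _, 0 => 1
  | 0, _ + 1 => 0
  | M + 1, n + 1 => q ^ (n + 1) * qBinom q M (n + 1) + qBinom q M n

/-- `S_m(N) = Σ_{c_1,…,c_{m−1}=0}^{N−1} (−1)^{c_{m−1}} ω^{c_{m−1}(c_{m−1}+1)/2}
Π_{i=1}^{m−2} ω^{c_i(c_i+1)} [c_{i+1} choose c_i]_ω`, `ω = exp(2πi/N)`, `m = p+2`. -/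
noncomputable def kashaevSum (p N : ℕ) : ℂ :=
  ∑ c : Fin (p + 1) → Fin N,
    (-1 : ℂ) ^ ((c (Fin.last p) : ℕ)) *
      Complex.exp (2 * (π : ℂ) * I / N) ^
        (((c (Fin.last p) : ℕ) * ((c (Fin.last p) : ℕ) + 1)) / 2) *
      ∏ j : Fin p,
        Complex.exp (2 * (π : ℂ) * I / N) ^
            ((c j.castSucc : ℕ) * ((c j.castSucc : ℕ) + 1)) *
          qBinom (Complex.exp (2 * (π : ℂ) * I / N)) (c j.succ) (c j.castSucc)

/-- The odd periodic function `χ_{2m}^{(a)} : ℤ → ℂ` with period `2m`, taking the value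
`+1` at `n ≡ m−1−a (mod 2m)`, `−1` at `n ≡ m+1+a (mod 2m)`, and `0` otherwise. -/
def chi (m a : ℕ) (n : ℤ) : ℂ :=
  if (n : ZMod (2 * m)) = ((m - 1 - a : ℕ) : ZMod (2 * m)) then 1
  else if (n : ZMod (2 * m)) = ((m + 1 + a : ℕ) : ZMod (2 * m)) then -1
  else 0

open Finset

/-- The finite `q`-Pochhammer symbol `(q; q)_n`. -/
def qPoch (q : ℂ) (n : ℕ) : ℂ := ∏ j ∈ range n, (1 - q ^ (j + 1))

lemma qPoch_succ (q : ℂ) (n : ℕ) : qPoch q (n + 1) = qPoch q n * (1 - q ^ (n + 1)) :=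
  prod_range_succ _ _

@[simp] lemma qPoch_zero (q : ℂ) : qPoch q 0 = 1 := prod_range_zero _

lemma qPoch_add (q : ℂ) (a b : ℕ) :
    qPoch q (a + b) = qPoch q a * ∏ j ∈ range b, (1 - q ^ (a + j + 1)) :=
  prod_range_add _ _ _

@[simp] lemma qBinom_zero_right (q : ℂ) (M : ℕ) : qBinom q M 0 = 1 := by
  cases M <;> rfl

lemma qBinom_succ_succ (q : ℂ) (M n : ℕ) :
    qBinom q (M + 1) (n + 1) = q ^ (n + 1) * qBinom q M (n + 1) + qBinom q M n := rfl

lemma qBinom_eq_zero_of_lt (q : ℂ) {M n : ℕ} (h : M < n) : qBinom q M n = 0 := by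
  induction M generalizing n with
  | zero => obtain ⟨n, rfl⟩ := Nat.exists_eq_succ_of_ne_zero h.ne'; rfl
  | succ M ih =>
    obtain ⟨n, rfl⟩ := Nat.exists_eq_succ_of_ne_zero (Nat.ne_of_gt (Nat.zero_lt_of_lt h))
    rw [Nat.succ_eq_add_one, qBinom_succ_succ, ih (by omega), ih (by omega)]
    simp

lemma qBinom_self (q : ℂ) (n : ℕ) : qBinom q n n = 1 := by
  induction n with
  | zero => rfl
  | succ n ih => rw [qBinom_succ_succ, ih, qBinom_eq_zero_of_lt q (Nat.lt_succ_self n)]; simp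

lemma qBinom_add_mul_qPoch (q : ℂ) (a b : ℕ) :
    qBinom q (a + b) b * (qPoch q a * qPoch q b) = qPoch q (a + b) := by
  induction a generalizing b with
  | zero => simp [qBinom_self]
  | succ a iha =>
    induction b with
    | zero => simp
    | succ b ihb =>
      have h₁ := iha (b + 1)
      rw [← add_assoc, qBinom_succ_succ, qPoch_succ q a, qPoch_succ q (a + 1 + b)]
      rw [qPoch_succ q b] at h₁ ⊢
      rw [qPoch_succ q a] at ihb
      have e : a + (b + 1) = a + 1 + b := by ring
      rw [e] at h₁
      calc _ = q ^ (b + 1) * (1 - q ^ (a + 1)) *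
              (qBinom q (a + 1 + b) (b + 1) * (qPoch q a * (qPoch q b * (1 - q ^ (b + 1))))) +
            (1 - q ^ (b + 1)) *
              (qBinom q (a + 1 + b) b * (qPoch q a * (1 - q ^ (a + 1)) * qPoch q b)) := by ring
        _ = _ := by rw [h₁, ihb]; ring

section Generic

variable {q : ℂ} {K : ℕ}

lemma qPoch_ne_zero (hq : ∀ j < K, 1 - q ^ (j + 1) ≠ 0) {n : ℕ} (hn : n ≤ K) :
    qPoch q n ≠ 0 :=
  prod_ne_zero_iff.2 fun j hj => hq j (by have := mem_range.1 hj; omega)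

lemma qBinom_mul_qBinom (hq : ∀ j < K, 1 - q ^ (j + 1) ≠ 0) {r s t : ℕ} (h : r + s + t ≤ K) :
    qBinom q (r + (s + t)) (r + s) * qBinom q (r + s) r =
      qBinom q (r + (s + t)) r * qBinom q (s + t) s := by
  have h₁ := qBinom_add_mul_qPoch q t (r + s)
  have h₂ := qBinom_add_mul_qPoch q s r
  have h₃ := qBinom_add_mul_qPoch q (s + t) r
  have h₄ := qBinom_add_mul_qPoch q t s
  have n₁ := qPoch_ne_zero hq (n := r) (by omega)
  have n₂ := qPoch_ne_zero hq (n := s) (by omega)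
  have n₃ := qPoch_ne_zero hq (n := t) (by omega)
  have n₄ := qPoch_ne_zero hq (n := r + s) (by omega)
  have n₅ := qPoch_ne_zero hq (n := s + t) (by omega)
  rw [show t + (r + s) = r + (s + t) by ring] at h₁
  rw [show s + r = r + s by ring] at h₂
  rw [show s + t + r = r + (s + t) by ring] at h₃
  rw [show t + s = s + t by ring] at h₄
  rw [eq_div_of_mul_eq (by positivity) h₁, eq_div_of_mul_eq (by positivity) h₂,
    eq_div_of_mul_eq (by positivity) h₃, eq_div_of_mul_eq (by positivity) h₄]
  field_simp

/-- A `q`-analogue of the Chu–Vandermonde summation. -/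
lemma sum_qBinom_div_qPoch (hq : ∀ j < K, 1 - q ^ (j + 1) ≠ 0) {n l : ℕ} (h : n + l ≤ K) :
    ∑ s ∈ range (n + 1), q ^ (s * (s + l)) * qBinom q n s / qPoch q (l + s) =
      1 / qPoch q (n + l) := by
  induction n generalizing l with
  | zero => simp
  | succ n ih =>
    rw [show n + 1 + l = n + (l + 1) by ring, ← ih (by omega), sum_range_succ']
    simp only [qBinom_succ_succ]
    have e : ∑ s ∈ range (n + 1), q ^ (s * (s + (l + 1))) * qBinom q n s / qPoch q (l + s) =
        ∑ s ∈ range (n + 1), q ^ ((s + 1) * (s + 1 + l)) * (q ^ (s + 1) * qBinom q n (s + 1)) /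
          qPoch q (l + (s + 1)) + q ^ (0 * (0 + l)) * qBinom q (n + 1) 0 / qPoch q (l + 0) := by
      rw [sum_range_succ', sum_range_succ _ n, qBinom_eq_zero_of_lt q (Nat.lt_succ_self n)]
      simp only [qBinom_zero_right, mul_zero, zero_div, add_zero, zero_mul]
      congr 1
      refine sum_congr rfl fun s _ => ?_
      ring
    rw [show ∀ A B C : ℂ, (A = B + C) ↔ (B + C = A) from fun _ _ _ => eq_comm] at e
    simp only [mul_add, add_div, sum_add_distrib]
    simp only [mul_add] at e
    rw [add_right_comm, e, ← sum_add_distrib]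
    refine sum_congr rfl fun s hs => ?_
    have hs := mem_range.1 hs
    have n₁ := qPoch_ne_zero hq (n := l + s) (by omega)
    have n₂ := hq (l + s) (by omega)
    rw [show l + 1 + s = l + s + 1 by ring, ← add_assoc l s 1, qPoch_succ]
    field_simp
    ring

/-- The Bailey chain `Σ Π_i q^{c_i(c_i+1)} [c_{i+1} choose c_i]` over
`c_1 ≤ ⋯ ≤ c_k = M`, started at the unit sequence. -/
def baileySum (q : ℂ) : ℕ → ℕ → ℂ
  | 0, M => if M = 0 then 1 else 0
  | k + 1, M => ∑ c ∈ range (M + 1), q ^ (c * (c + 1)) * qBinom q M c * baileySum q k c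

lemma baileySum_one (q : ℂ) (M : ℕ) : baileySum q 1 M = 1 := by
  rw [baileySum, sum_range_succ']
  simp [baileySum]

lemma sum_unit_bailey (hq : ∀ j < K, 1 - q ^ (j + 1) ≠ 0) {M : ℕ} (hM : 2 * M + 1 ≤ K) :
    ∑ r ∈ range (M + 1), (-1) ^ r * q ^ (r.choose 2) * (1 - q ^ (2 * r + 1)) *
      (qPoch q r * qBinom q M r / qPoch q (M + r + 1)) = if M = 0 then 1 else 0 := by
  rcases M with _ | n
  · have := hq 0 (by omega)
    simp [qPoch]
    simp at this
    field_simp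
  have key : ∀ R ≤ n + 1, (1 - q ^ (n + 1)) * ∑ r ∈ range R,
      (-1) ^ r * q ^ (r.choose 2) * (1 - q ^ (2 * r + 1)) *
        (qPoch q r * qBinom q (n + 1) r / qPoch q (n + 1 + r + 1)) =
      -((1 - q ^ R) * ((-1) ^ R * q ^ (R.choose 2)) *
        (qPoch q (n + 1) / (qPoch q (n + 1 - R) * qPoch q (n + 1 + R)))) := by
    intro R
    induction R with
    | zero => simp
    | succ R ih =>
      intro hR
      obtain ⟨t, ht⟩ := Nat.exists_eq_add_of_le hR
      have h₁ := qBinom_add_mul_qPoch q (t + 1) R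
      have n₁ := qPoch_ne_zero hq (n := t) (by omega)
      have n₂ := hq t (by omega)
      have n₃ := qPoch_ne_zero hq (n := n + 1 + R) (by omega)
      have n₄ := hq (n + 1 + R) (by omega)
      have n₅ := qPoch_ne_zero hq (n := R) (by omega)
      rw [sum_range_succ, mul_add, ih (by omega)]
      rw [show t + 1 + R = n + 1 by omega] at h₁
      rw [show n + 1 - R = t + 1 by omega, show n + 1 - (R + 1) = t by omega, ← add_assoc,
        qPoch_succ q (n + 1 + R), qPoch_succ q t, ← h₁, qPoch_succ q t,
        Nat.choose_succ_succ' R 1, Nat.choose_one_right]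
      field_simp
      rw [show n + 1 = t + R + 1 by omega]
      ring
  have hn := hq n (by omega)
  rw [if_neg (Nat.succ_ne_zero n)]
  refine (mul_eq_zero.1 (?_ : (1 - q ^ (n + 1)) * _ = 0)).resolve_left hn
  rw [sum_range_succ, mul_add, key (n + 1) le_rfl, qBinom_self, Nat.sub_self, qPoch_zero,
    qPoch_succ q (n + 1 + (n + 1))]
  have n₃ := qPoch_ne_zero hq (n := n + 1 + (n + 1)) (by omega)
  have n₄ := hq (n + 1 + (n + 1)) (by omega)
  field_simp
  ring

/-- The Bailey pair obtained by iterating the Bailey lemma on the unit pair relative to `q`. -/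
lemma baileySum_eq (hq : ∀ j < K, 1 - q ^ (j + 1) ≠ 0) (k : ℕ) {M : ℕ} (hM : 2 * M + 1 ≤ K) :
    baileySum q k M = ∑ r ∈ range (M + 1),
      (-1) ^ r * q ^ (k * (r * (r + 1)) + r.choose 2) * (1 - q ^ (2 * r + 1)) *
        (qPoch q r * qBinom q M r / qPoch q (M + r + 1)) := by
  induction k generalizing M with
  | zero => simpa [baileySum] using (sum_unit_bailey hq hM).symm
  | succ k ih =>
    have h₁ : baileySum q (k + 1) M = ∑ c ∈ Ico 0 (M + 1), ∑ r ∈ Ico 0 (c + 1),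
        q ^ (c * (c + 1)) * qBinom q M c *
          ((-1) ^ r * q ^ (k * (r * (r + 1)) + r.choose 2) * (1 - q ^ (2 * r + 1)) *
            (qPoch q r * qBinom q c r / qPoch q (c + r + 1))) := by
      rw [baileySum, ← range_eq_Ico]
      refine sum_congr rfl fun c hc => ?_
      rw [ih (by have := mem_range.1 hc; omega), mul_sum, ← range_eq_Ico]
    rw [h₁, ← sum_Ico_Ico_comm, ← range_eq_Ico]
    refine sum_congr rfl fun r hr => ?_
    obtain ⟨n, rfl⟩ := Nat.exists_eq_add_of_le (Nat.lt_succ_iff.1 (mem_range.1 hr))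
    rw [sum_Ico_eq_sum_range, show r + n + 1 - r = n + 1 by omega]
    have hv := sum_qBinom_div_qPoch hq (n := n) (l := 2 * r + 1) (by omega)
    rw [show r + n + r + 1 = n + (2 * r + 1) by ring, mul_div_assoc, ← mul_one_div, ← hv,
      mul_sum, mul_sum, mul_sum]
    refine sum_congr rfl fun s hs => ?_
    obtain ⟨t, rfl⟩ := Nat.exists_eq_add_of_le (Nat.lt_succ_iff.1 (mem_range.1 hs))
    have hb := qBinom_mul_qBinom hq (r := r) (s := s) (t := t) (by omega)
    rw [show r + s + r + 1 = 2 * r + 1 + s by ring]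
    calc _ = q ^ ((r + s) * (r + s + 1)) * (-1) ^ r * q ^ (k * (r * (r + 1)) + r.choose 2) *
          (1 - q ^ (2 * r + 1)) * (qPoch q r / qPoch q (2 * r + 1 + s)) *
          (qBinom q (r + (s + t)) (r + s) * qBinom q (r + s) r) := by ring
      _ = _ := by rw [hb]; ring

end Generic

lemma sum_kashaev_eq (q : ℂ) (p N : ℕ) (g : ℕ → ℂ) :
    ∑ c : Fin (p + 1) → Fin N, g (c (Fin.last p)) * ∏ j : Fin p,
        (q ^ ((c j.castSucc : ℕ) * ((c j.castSucc : ℕ) + 1)) *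
          qBinom q (c j.succ) (c j.castSucc)) =
      ∑ c ∈ range N, g c * baileySum q (p + 1) c := by
  induction p generalizing g with
  | zero =>
    rw [← (Equiv.funUnique (Fin 1) (Fin N)).symm.sum_comp, sum_range]
    simp [baileySum_one]
  | succ p ih =>
    rw [← (Fin.snocEquiv fun _ => Fin N).sum_comp, Fintype.sum_prod_type, sum_range]
    refine sum_congr rfl fun x _ => ?_
    have h := ih fun y => q ^ (y * (y + 1)) * qBinom q x y
    have h₂ : baileySum q (p + 1 + 1) x =
        ∑ c ∈ range N, q ^ (c * (c + 1)) * qBinom q x c * baileySum q (p + 1) c := by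
      rw [baileySum]
      refine sum_subset (range_subset_range.2 x.2) fun c _ hc => ?_
      rw [qBinom_eq_zero_of_lt q (by simpa using hc)]
      simp
    rw [h₂, ← h, mul_sum]
    refine sum_congr rfl fun c _ => ?_
    rw [Fin.prod_univ_castSucc]
    simp only [Fin.snocEquiv_apply, Fin.snoc_last, Fin.snoc_castSucc, Fin.succ_last,
      ← Fin.castSucc_succ]
    ring

open scoped Topology

lemma differentiable_qBinom (M n : ℕ) : Differentiable ℂ fun q => qBinom q M n := by
  induction M generalizing n with
  | zero => cases n <;> exact differentiable_const _
  | succ M ih =>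
    cases n with
    | zero => exact differentiable_const _
    | succ n => exact ((differentiable_id.pow _).mul (ih _)).add (ih _)

lemma differentiable_baileySum (k M : ℕ) : Differentiable ℂ fun q => baileySum q k M := by
  induction k generalizing M with
  | zero => exact differentiable_const _
  | succ k ih =>
    exact .fun_sum fun c _ => ((differentiable_id.pow _).mul (differentiable_qBinom M c)).mul (ih c)

lemma hasDerivAt_pow_div {q : ℂ} (hq : q ≠ 0) (n : ℕ) :
    HasDerivAt (fun z : ℂ => z ^ n) (n * q ^ n / q) q := by
  refine (hasDerivAt_pow n q).congr_deriv ?_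
  cases n with
  | zero => simp
  | succ n => rw [Nat.add_sub_cancel, pow_succ]; field_simp

lemma hasDerivAt_prod_one_sub_pow {q : ℂ} (hq : q ≠ 0) (a b : ℕ)
    (h : ∀ j < b, 1 - q ^ (a + j + 1) ≠ 0) :
    HasDerivAt (fun z : ℂ => ∏ j ∈ range b, (1 - z ^ (a + j + 1)))
      (-(∏ j ∈ range b, (1 - q ^ (a + j + 1))) / q *
        ∑ j ∈ range b, ((a : ℂ) + j + 1) * (q ^ (a + j + 1) / (1 - q ^ (a + j + 1)))) q := by
  induction b with
  | zero => simpa using hasDerivAt_const q (1 : ℂ)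
  | succ b ih =>
    simp only [prod_range_succ, sum_range_succ]
    have hb := h b b.lt_succ_self
    refine ((ih fun j hj => h j (hj.trans b.lt_succ_self)).mul
      ((hasDerivAt_pow_div hq (a + b + 1)).const_sub 1)).congr_deriv ?_
    push_cast
    field_simp
    ring

/-- The `r`-th summand of `(1 - q ^ (n + 1)) * baileySum q (k + 1) n`, which extends
continuously to primitive `(n + 1)`-st roots of unity. -/
noncomputable def baileyTerm (k n r : ℕ) (q : ℂ) : ℂ :=
  (-1) ^ r * (q ^ ((k + 1) * (r * (r + 1)) + r.choose 2) -
      q ^ ((k + 1) * (r * (r + 1)) + r.choose 2 + (2 * r + 1))) *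
    (qPoch q (n - r) * ∏ j ∈ range r, (1 - q ^ (n + 1 + j + 1)))⁻¹

lemma one_sub_pow_mul_baileySum {q : ℂ} {k n : ℕ} (hq : ∀ j < 2 * n + 1, 1 - q ^ (j + 1) ≠ 0) :
    (1 - q ^ (n + 1)) * baileySum q (k + 1) n = ∑ r ∈ range (n + 1), baileyTerm k n r q := by
  rw [baileySum_eq hq (k + 1) le_rfl, mul_sum]
  refine sum_congr rfl fun r hr => ?_
  obtain ⟨s, rfl⟩ := Nat.exists_eq_add_of_le (Nat.lt_succ_iff.1 (mem_range.1 hr))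
  have h₁ := qBinom_add_mul_qPoch q s r
  have n₁ := qPoch_ne_zero hq (n := s) (by omega)
  have n₂ := qPoch_ne_zero hq (n := r + s) (by omega)
  have n₃ := hq (r + s) (by omega)
  have n₄ : ∏ j ∈ range r, (1 - q ^ (r + s + 1 + j + 1)) ≠ 0 :=
    prod_ne_zero_iff.2 fun j hj => hq (r + s + 1 + j) (by have := mem_range.1 hj; omega)
  rw [baileyTerm, show r + s + r + 1 = r + s + 1 + r by ring, qPoch_add, qPoch_succ,
    Nat.add_sub_cancel_left]
  rw [add_comm s r] at h₁
  rw [← h₁] at n₂ ⊢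
  have n₅ := (mul_ne_zero_iff.1 n₂).1
  have n₆ := (mul_ne_zero_iff.1 (mul_ne_zero_iff.1 n₂).2).2
  field_simp
  ring

section RootOfUnity

variable {ω : ℂ} {n : ℕ}

lemma one_sub_pow_ne_zero (hω : IsPrimitiveRoot ω (n + 1)) {j : ℕ} (hj : j < n) :
    1 - ω ^ (j + 1) ≠ 0 :=
  sub_ne_zero.2 (hω.pow_ne_one_of_pos_of_lt (Nat.succ_ne_zero j) (by omega)).symm

lemma pow_add_order (hω : IsPrimitiveRoot ω (n + 1)) (j : ℕ) : ω ^ (n + 1 + j) = ω ^ j := by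
  rw [pow_add, hω.pow_eq_one, one_mul]

lemma pow_eq_pow_of_add_mul (hω : IsPrimitiveRoot ω (n + 1)) {a b : ℕ} (x y : ℕ)
    (h : a + (n + 1) * x = b + (n + 1) * y) : ω ^ a = ω ^ b := by
  simpa [pow_add, pow_mul, hω.pow_eq_one] using congrArg (ω ^ ·) h

lemma qPoch_mul_qPoch_of_isPrimitiveRoot (hω : IsPrimitiveRoot ω (n + 1)) {r s : ℕ}
    (h : s + r = n) :
    qPoch ω s * qPoch ω r = (n + 1) * ((-1) ^ r * ω ^ ((r + 1).choose 2)) := by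
  induction r generalizing s with
  | zero => subst h; simpa [qPoch] using hω.prod_one_sub_pow_eq_order
  | succ r ih =>
    have hs := ih (s := s + 1) (by omega)
    have n₁ := one_sub_pow_ne_zero hω (j := s) (by omega)
    have e : ω ^ (s + 1) * ω ^ (r + 1) = 1 := by
      rw [← pow_add, show s + 1 + (r + 1) = n + 1 by omega, hω.pow_eq_one]
    rw [qPoch_succ] at hs
    rw [qPoch_succ, Nat.choose_succ_succ' (r + 1) 1, Nat.choose_one_right, pow_add, pow_succ]
    refine mul_left_cancel₀ n₁ ?_
    calc _ = (qPoch ω s * (1 - ω ^ (s + 1)) * qPoch ω r) * (1 - ω ^ (r + 1)) := by ring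
      _ = (n + 1) * ((-1) ^ r * ω ^ ((r + 1).choose 2)) * (1 - ω ^ (r + 1)) := by rw [hs]
      _ = _ := by linear_combination
                    -(n + 1) * ((-1) ^ r * ω ^ ((r + 1).choose 2)) * e

lemma pow_mul_qBinom_of_isPrimitiveRoot (hω : IsPrimitiveRoot ω (n + 1)) {c : ℕ} (hc : c ≤ n) :
    ω ^ (c * (c + 1)) * qBinom ω n c = (-1) ^ c * ω ^ (c * (c + 1) / 2) := by
  obtain ⟨s, rfl⟩ := Nat.exists_eq_add_of_le' hc
  have h₁ := qBinom_add_mul_qPoch ω s c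
  have h₂ := qPoch_mul_qPoch_of_isPrimitiveRoot hω (r := 0) (s := s + c) rfl
  rw [qPoch_mul_qPoch_of_isPrimitiveRoot hω rfl] at h₁
  simp only [qPoch_zero, mul_one, pow_zero, zero_add, Nat.choose_succ_self] at h₂
  have e : c * (c + 1) / 2 = (c + 1).choose 2 := by
    rw [Nat.choose_two_right, Nat.add_sub_cancel, mul_comm]
  have e₂ : c * (c + 1) = (c + 1).choose 2 + (c + 1).choose 2 := by
    rw [← e, ← mul_two, Nat.div_mul_cancel (Nat.even_mul_succ_self c).two_dvd]
  have hN : ((s + c : ℕ) : ℂ) + 1 ≠ 0 := Nat.cast_add_one_ne_zero _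
  rw [h₂] at h₁
  have h₃ : qBinom ω (s + c) c * ((-1) ^ c * ω ^ ((c + 1).choose 2)) = 1 :=
    mul_left_cancel₀ hN (by linear_combination h₁)
  have h₄ : ((-1 : ℂ) ^ c) * (-1) ^ c = 1 := by rw [← mul_pow]; simp
  rw [e, e₂, pow_add]
  linear_combination (-1) ^ c * ω ^ ((c + 1).choose 2) * h₃ -
    ω ^ ((c + 1).choose 2) * ω ^ ((c + 1).choose 2) * qBinom ω (s + c) c * h₄

/-- The sum `Σ_{j=1}^{r} ω^j / (1 - ω^j)`. -/
noncomputable def harmonicSum (ω : ℂ) (r : ℕ) : ℂ := ∑ j ∈ range r, ω ^ (j + 1) / (1 - ω ^ (j + 1))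

lemma harmonicSum_sub (hω : IsPrimitiveRoot ω (n + 1)) {r : ℕ} (hr : r ≤ n) :
    harmonicSum ω r - harmonicSum ω (n - r) = n / 2 - r := by
  have key : ∀ r ≤ n, harmonicSum ω r - harmonicSum ω (n - r) = -harmonicSum ω n - r := by
    intro r
    induction r with
    | zero => simp [harmonicSum]
    | succ r ih =>
      intro hr
      obtain ⟨t, rfl⟩ := Nat.exists_eq_add_of_le hr
      have h := ih (by omega)
      have n₁ := one_sub_pow_ne_zero hω (j := r) (by omega)
      have n₂ := one_sub_pow_ne_zero hω (j := t) (by omega)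
      have e : ω ^ (r + 1) * ω ^ (t + 1) = 1 := by
        rw [← pow_add, show r + 1 + (t + 1) = r + 1 + t + 1 by omega, hω.pow_eq_one]
      have x : ω ^ (r + 1) / (1 - ω ^ (r + 1)) + ω ^ (t + 1) / (1 - ω ^ (t + 1)) = -1 := by
        field_simp
        linear_combination -e
      rw [show r + 1 + t - r = t + 1 by omega] at h
      rw [show r + 1 + t - (r + 1) = t by omega]
      have a₁ : harmonicSum ω (r + 1) = harmonicSum ω r + ω ^ (r + 1) / (1 - ω ^ (r + 1)) :=
        sum_range_succ _ _
      have a₂ : harmonicSum ω (t + 1) = harmonicSum ω t + ω ^ (t + 1) / (1 - ω ^ (t + 1)) :=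
        sum_range_succ _ _
      push_cast
      linear_combination h + x + a₁ + a₂
  have h := key n le_rfl
  simp only [Nat.sub_self, harmonicSum, range_zero, sum_empty] at h
  rw [key r hr, harmonicSum]
  linear_combination -h / 2

/-- The negative logarithmic derivative, times `ω`, of the denominator of `baileyTerm`. -/
noncomputable def denomLogDeriv (ω : ℂ) (n r : ℕ) : ℂ :=
  (∑ j ∈ range (n - r), ((j : ℂ) + 1) * (ω ^ (j + 1) / (1 - ω ^ (j + 1)))) +
    ∑ j ∈ range r, ((n : ℂ) + 1 + j + 1) * (ω ^ (j + 1) / (1 - ω ^ (j + 1)))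

lemma denomLogDeriv_sub (hω : IsPrimitiveRoot ω (n + 1)) {r : ℕ} (hr : r ≤ n) :
    denomLogDeriv ω n r - denomLogDeriv ω n (n - r) = (n + 1) * (n / 2 - r) := by
  have split : ∀ r, ∑ j ∈ range r, ((n : ℂ) + 1 + j + 1) * (ω ^ (j + 1) / (1 - ω ^ (j + 1))) =
      (n + 1) * harmonicSum ω r +
        ∑ j ∈ range r, ((j : ℂ) + 1) * (ω ^ (j + 1) / (1 - ω ^ (j + 1))) := by
    intro r
    rw [harmonicSum, mul_sum, ← sum_add_distrib]
    exact sum_congr rfl fun j _ => by ring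
  rw [denomLogDeriv, denomLogDeriv, Nat.sub_sub_self hr, split, split]
  linear_combination (n + 1) * harmonicSum_sub hω hr

lemma hasDerivAt_baileyTerm (hω : IsPrimitiveRoot ω (n + 1)) (k : ℕ) {r : ℕ} (hr : r ≤ n) :
    HasDerivAt (baileyTerm k n r)
      (1 / (ω * (n + 1)) *
        (((k + 1) * (r * (r + 1)) + r * (r - 1) / 2 + denomLogDeriv ω n r) *
            ω ^ (k * (r * (r + 1)) + r * r) -
          ((k + 1) * (r * (r + 1)) + r * (r - 1) / 2 + (2 * r + 1) + denomLogDeriv ω n r) *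
            ω ^ ((k + 1) * (r * (r + 1)) + r + 1))) ω := by
  have h0 : ω ≠ 0 := hω.ne_zero (Nat.succ_ne_zero n)
  have d₁ := hasDerivAt_prod_one_sub_pow h0 0 (n - r) fun j hj => by
    rw [zero_add]; exact one_sub_pow_ne_zero hω (by omega)
  have d₂ := hasDerivAt_prod_one_sub_pow h0 (n + 1) r fun j hj => by
    rw [add_assoc, pow_add_order hω]; exact one_sub_pow_ne_zero hω (by omega)
  have hP := qPoch_mul_qPoch_of_isPrimitiveRoot hω (Nat.sub_add_cancel hr)
  have hN : (n : ℂ) + 1 ≠ 0 := Nat.cast_add_one_ne_zero n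
  have hP0 : qPoch ω (n - r) * qPoch ω r ≠ 0 := by
    rw [hP]
    exact mul_ne_zero hN (mul_ne_zero (pow_ne_zero _ (by norm_num)) (pow_ne_zero _ h0))
  simp only [zero_add, Nat.cast_zero] at d₁
  simp only [add_assoc (n + 1), pow_add_order hω] at d₂
  change HasDerivAt _ (-qPoch ω (n - r) / ω * _) ω at d₁
  change HasDerivAt _ (-qPoch ω r / ω * _) ω at d₂
  have d₃ := (d₁.fun_mul d₂).fun_inv (by
    simpa only [add_assoc (n + 1), pow_add_order hω, qPoch] using hP0)
  have d₄ := (((hasDerivAt_pow_div h0 ((k + 1) * (r * (r + 1)) + r.choose 2)).fun_sub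
    (hasDerivAt_pow_div h0 ((k + 1) * (r * (r + 1)) + r.choose 2 + (2 * r + 1)))).const_mul
      ((-1 : ℂ) ^ r)).fun_mul d₃
  refine d₄.congr_deriv ?_
  simp only [pow_add_order hω]
  change (_ * _) * (qPoch ω (n - r) * qPoch ω r)⁻¹ + _ *
    (-(-qPoch ω (n - r) / ω * _ * qPoch ω r + qPoch ω (n - r) * (-qPoch ω r / ω * _)) /
      (qPoch ω (n - r) * qPoch ω r) ^ 2) = _
  generalize qPoch ω (n - r) = P at *
  generalize qPoch ω r = Q at *
  rw [denomLogDeriv]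
  push_cast
  generalize ∑ j ∈ range (n - r), ((j : ℂ) + 1) * (ω ^ (j + 1) / (1 - ω ^ (j + 1))) = S₁
  generalize ∑ j ∈ range r, ((n : ℂ) + 1 + j + 1) * (ω ^ (j + 1) / (1 - ω ^ (j + 1))) = S₂
  have e₁ : ω ^ ((k + 1) * (r * (r + 1)) + r.choose 2) =
      ω ^ ((r + 1).choose 2) * ω ^ (k * (r * (r + 1)) + r * r) := by
    rw [← pow_add, Nat.choose_succ_succ' r 1, Nat.choose_one_right]
    ring
  have e₂ : ω ^ ((k + 1) * (r * (r + 1)) + r.choose 2 + (2 * r + 1)) =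
      ω ^ ((r + 1).choose 2) * ω ^ ((k + 1) * (r * (r + 1)) + r + 1) := by
    rw [← pow_add, Nat.choose_succ_succ' r 1, Nat.choose_one_right]
    ring
  rw [e₁, e₂, Nat.cast_choose_two]
  generalize ω ^ (k * (r * (r + 1)) + r * r) = B
  generalize ω ^ ((k + 1) * (r * (r + 1)) + r + 1) = C
  have hW : ω ^ ((r + 1).choose 2) ≠ 0 := pow_ne_zero _ h0
  generalize ω ^ ((r + 1).choose 2) = W at *
  have hσ : ((-1 : ℂ) ^ r) ≠ 0 := pow_ne_zero _ (by norm_num)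
  generalize ((-1 : ℂ) ^ r) = σ at *
  have inv : -(-P / ω * S₁ * Q + P * (-Q / ω * S₂)) / (P * Q) ^ 2 =
      (S₁ + S₂) / (ω * (P * Q)) := by
    have := left_ne_zero_of_mul hP0
    have := right_ne_zero_of_mul hP0
    field_simp
    ring
  rw [inv, hP]
  field_simp
  ring

lemma baileySum_of_isPrimitiveRoot (hω : IsPrimitiveRoot ω (n + 1)) (k : ℕ) :
    baileySum ω (k + 1) n = ∑ r ∈ range (n + 1), ω ^ (k * (r * (r + 1)) + r * r) *
      (k + 1 - (2 * (k + 1) * r + k) / (n + 1)) := by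
  have h0 : ω ≠ 0 := hω.ne_zero (Nat.succ_ne_zero n)
  have hN : (n : ℂ) + 1 ≠ 0 := Nat.cast_add_one_ne_zero n
  have dL := ((hasDerivAt_pow_div h0 (n + 1)).const_sub 1).fun_mul
    (differentiable_baileySum (k + 1) n ω).hasDerivAt
  have dR := HasDerivAt.fun_sum fun r (hr : r ∈ range (n + 1)) =>
    hasDerivAt_baileyTerm hω k (Nat.lt_succ_iff.1 (mem_range.1 hr))
  have hev : ∀ᶠ q in 𝓝[≠] ω, ∀ j ∈ range (2 * n + 1), 1 - q ^ (j + 1) ≠ 0 := by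
    refine (Filter.eventually_all_finset _).2 fun j _ => ?_
    filter_upwards [(hasDerivAt_pow_div h0 (j + 1)).eventually_ne (c := 1) (by
      simp [h0, Nat.cast_add_one_ne_zero])] with q hq
    exact sub_ne_zero.2 hq.symm
  have heq := (dL.continuousAt.eventuallyEq_nhds_iff_eventuallyEq_nhdsNE dR.continuousAt).1
    (hev.mono fun q hq => one_sub_pow_mul_baileySum fun j hj => hq j (mem_range.2 hj))
  have hder := dL.unique (dR.congr_of_eventuallyEq heq)
  rw [hω.pow_eq_one, ← mul_sum, sum_sub_distrib] at hder
  have hreflect : ∑ r ∈ range (n + 1), ((k + 1) * (r * (r + 1)) + r * (r - 1) / 2 + (2 * r + 1) +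
        denomLogDeriv ω n r) * ω ^ ((k + 1) * (r * (r + 1)) + r + 1) =
      ∑ r ∈ range (n + 1), ((k + 1) * ((n - r) * (n - r + 1)) + (n - r) * (n - r - 1) / 2 +
        (2 * (n - r) + 1) + denomLogDeriv ω n (n - r)) * ω ^ (k * (r * (r + 1)) + r * r) := by
    rw [← sum_range_reflect]
    refine sum_congr rfl fun r hr => ?_
    obtain ⟨s, rfl⟩ := Nat.exists_eq_add_of_le (Nat.lt_succ_iff.1 (mem_range.1 hr))
    rw [show r + s + 1 - 1 - r = s by omega, show r + s - r = s by omega]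
    have e : ω ^ ((k + 1) * (s * (s + 1)) + s + 1) = ω ^ (k * (r * (r + 1)) + r * r) :=
      pow_eq_pow_of_add_mul hω (k * (2 * r + 1) + 2 * r) (k * (r + s + 1) + r + s + 1) (by ring)
    rw [e]
    push_cast
    ring
  rw [hreflect, ← sum_sub_distrib] at hder
  have hsum : ∑ r ∈ range (n + 1), (((k + 1) * (r * (r + 1)) + r * (r - 1) / 2 +
        denomLogDeriv ω n r) * ω ^ (k * (r * (r + 1)) + r * r) -
      ((k + 1) * ((n - r) * (n - r + 1)) + (n - r) * (n - r - 1) / 2 +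
        (2 * (n - r) + 1) + denomLogDeriv ω n (n - r)) * ω ^ (k * (r * (r + 1)) + r * r)) =
      -(n + 1) ^ 2 * ∑ r ∈ range (n + 1), ω ^ (k * (r * (r + 1)) + r * r) *
        (k + 1 - (2 * (k + 1) * r + k) / (n + 1)) := by
    rw [mul_sum]
    refine sum_congr rfl fun r hr => ?_
    have h := denomLogDeriv_sub hω (Nat.lt_succ_iff.1 (mem_range.1 hr))
    field_simp
    linear_combination 2 * h
  rw [hsum] at hder
  generalize ∑ r ∈ range (n + 1), ω ^ (k * (r * (r + 1)) + r * r) *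
    (k + 1 - (2 * (k + 1) * r + k) / ((n : ℂ) + 1)) = S at hder ⊢
  push_cast at hder
  field_simp at hder
  exact mul_left_cancel₀ hN (by linear_combination -hder)

end RootOfUnity

lemma kashaevSum_eq (p n : ℕ) :
    kashaevSum p (n + 1) =
      baileySum (Complex.exp (2 * (π : ℂ) * I / (n + 1 : ℕ))) (p + 2) n := by
  have hω := Complex.isPrimitiveRoot_exp (n + 1) n.succ_ne_zero
  rw [kashaevSum]
  generalize Complex.exp (2 * (π : ℂ) * I / (n + 1 : ℕ)) = ω at *
  rw [baileySum, ← sum_kashaev_eq ω p (n + 1) fun c => ω ^ (c * (c + 1)) * qBinom ω n c]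
  refine sum_congr rfl fun c _ => ?_
  rw [pow_mul_qBinom_of_isPrimitiveRoot hω (Nat.lt_succ_iff.1 (c (Fin.last p)).2)]

lemma chi_zero_natCast {m : ℕ} (hm : 2 ≤ m) (n : ℕ) :
    chi m 0 n = (if n % (2 * m) = m - 1 then 1 else 0) -
      if n % (2 * m) = m + 1 then 1 else 0 := by
  simp only [chi, Int.cast_natCast, ZMod.natCast_eq_natCast_iff', Nat.sub_zero, add_zero,
    Nat.mod_eq_of_lt (show m - 1 < 2 * m by omega), Nat.mod_eq_of_lt (show m + 1 < 2 * m by omega)]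
  split_ifs <;> first | omega | simp

lemma mod_eq_add_one_iff {m N x y : ℕ} (hm : 2 ≤ m) (h : x + y = 2 * m * N) :
    x % (2 * m) = m + 1 ↔ y % (2 * m) = m - 1 := by
  have hx := Nat.mod_lt x (show 0 < 2 * m by omega)
  have hy := Nat.mod_lt y (show 0 < 2 * m by omega)
  have hd : (x % (2 * m) + y % (2 * m)) % (2 * m) = 0 := by
    rw [← Nat.add_mod, h, Nat.mul_mod_right]
  by_cases hlt : x % (2 * m) + y % (2 * m) < 2 * m
  · rw [Nat.mod_eq_of_lt hlt] at hd
    omega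
  · rw [Nat.mod_eq_sub_mod (not_lt.1 hlt), Nat.mod_eq_of_lt (by omega)] at hd
    omega

lemma sum_range_mul_indicator {M a : ℕ} (ha : a < M) (N : ℕ) (g : ℕ → ℂ) :
    ∑ n ∈ range (M * N), (if n % M = a then 1 else 0) * g n =
      ∑ r ∈ range N, g (M * r + a) := by
  induction N with
  | zero => simp
  | succ N ih =>
    rw [Nat.mul_succ, sum_range_add, ih, sum_range_succ]
    congr 1
    rw [sum_eq_single_of_mem a (mem_range.2 ha)]
    · simp [Nat.mod_eq_of_lt ha]
    · intro s hs hsa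
      rw [Nat.mul_add_mod, Nat.mod_eq_of_lt (mem_range.1 hs), if_neg hsa, zero_mul]

/-- Folding a sum against `chi m 0` over half a period into a sum over one residue class. -/
lemma sum_chi_mul {m : ℕ} (hm : 2 ≤ m) (N : ℕ) (g : ℕ → ℂ)
    (hg : ∀ x y, x + y = 2 * m * N → g x = -g y) :
    ∑ n ∈ range (m * N + 1), chi m 0 n * g n = ∑ r ∈ range N, g (2 * m * r + (m - 1)) := by
  have h0 : g (m * N) = 0 := self_eq_neg.1 (hg _ _ (by ring))
  have hb : ∑ n ∈ range (m * N + 1), (if n % (2 * m) = m + 1 then (1 : ℂ) else 0) * g n =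
      -∑ i ∈ range (m * N), (if (m * N + i) % (2 * m) = m - 1 then 1 else 0) * g (m * N + i) := by
    have hlast : (m * N + m * N) % (2 * m) ≠ m - 1 := by
      rw [show m * N + m * N = 2 * m * N by ring, Nat.mul_mod_right]
      omega
    have hext : ∑ i ∈ range (m * N),
        (if (m * N + i) % (2 * m) = m - 1 then (1 : ℂ) else 0) * g (m * N + i) =
        ∑ i ∈ range (m * N + 1),
          (if (m * N + i) % (2 * m) = m - 1 then (1 : ℂ) else 0) * g (m * N + i) := by
      rw [sum_range_succ, if_neg hlast, zero_mul, add_zero]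
    rw [← sum_range_reflect, hext, ← sum_neg_distrib]
    refine sum_congr rfl fun i hi => ?_
    have hi := mem_range.1 hi
    have hxy : m * N + 1 - 1 - i + (m * N + i) = 2 * m * N := by
      rw [show 2 * m * N = m * N + m * N by ring]
      omega
    simp only [mod_eq_add_one_iff hm hxy, hg _ _ hxy, mul_neg]
  simp only [chi_zero_natCast hm, sub_mul, sum_sub_distrib]
  rw [hb, sum_range_succ, h0, ← sum_range_mul_indicator (show m - 1 < 2 * m by omega) N g,
    show 2 * m * N = m * N + m * N by ring, sum_range_add]
  ring

/-- for `m ≥ 2` (`m = p+2`), `N ≥ 1` and `ω = exp(2πi/N)`,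
`e^{(m−1)²πi/(2mN)} S_m(N) = m Σ_{n=0}^{mN} χ_{2m}^{(0)}(n) (1 − n/(mN)) e^{πin²/(2mN)}`
(the case `a = 0` of the paper's Conjecture 2). -/
theorem stmt12 (m p : ℕ) (hm : m = p + 2) (N : ℕ) (hN : 0 < N) :
    Complex.exp (((m : ℂ) - 1) ^ 2 * (π : ℂ) * I / (2 * m * N)) * kashaevSum p N =
      (m : ℂ) * ∑ n ∈ Finset.range (m * N + 1),
        chi m 0 n * (1 - (n : ℂ) / (m * N)) *
          Complex.exp ((π : ℂ) * I * (n : ℂ) ^ 2 / (2 * m * N)) := by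
  subst hm
  obtain ⟨n, rfl⟩ := Nat.exists_eq_succ_of_ne_zero hN.ne'
  have hm0 : ((p + 2 : ℕ) : ℂ) ≠ 0 := Nat.cast_ne_zero.2 (by omega)
  have hN0 : ((n + 1 : ℕ) : ℂ) ≠ 0 := Nat.cast_ne_zero.2 (by omega)
  simp only [mul_assoc (chi _ _ _)]
  rw [Nat.succ_eq_add_one, sum_chi_mul (by omega) (n + 1) fun x => (1 - (x : ℂ) /
    ((p + 2 : ℕ) * (n + 1 : ℕ))) * Complex.exp ((π : ℂ) * I * (x : ℂ) ^ 2 /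
      (2 * (p + 2 : ℕ) * (n + 1 : ℕ)))]
  · rw [kashaevSum_eq, baileySum_of_isPrimitiveRoot
      (Complex.isPrimitiveRoot_exp (n + 1) n.succ_ne_zero) (p + 1), mul_sum, mul_sum]
    refine sum_congr rfl fun r _ => ?_
    rw [← mul_assoc, ← Complex.exp_nat_mul, ← Complex.exp_add, mul_comm,
      show p + 2 - 1 = p + 1 by omega, ← mul_assoc (_ : ℂ) _ (Complex.exp _)]
    congr 1
    · field_simp
      push_cast
      ring
    · congr 1
      field_simp
      push_cast
      ring
  · intro x y hxy
    have hy : (y : ℂ) = 2 * (p + 2 : ℕ) * (n + 1 : ℕ) - x := by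
      rw [eq_sub_iff_add_eq']; exact_mod_cast hxy
    have he : Complex.exp ((π : ℂ) * I * (y : ℂ) ^ 2 / (2 * (p + 2 : ℕ) * (n + 1 : ℕ))) =
        Complex.exp ((π : ℂ) * I * (x : ℂ) ^ 2 / (2 * (p + 2 : ℕ) * (n + 1 : ℕ))) := by
      refine Complex.exp_eq_exp_iff_exists_int.2 ⟨(p + 2 : ℕ) * (n + 1 : ℕ) - x, ?_⟩
      rw [hy, Int.cast_sub, Int.cast_mul, Int.cast_natCast, Int.cast_natCast, Int.cast_natCast]
      field_simp
      ring
    rw [he, hy]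
    field_simp
    ring
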